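/- arXiv:1805.06004 — 5 statements merged into one kernel-verified Lean document; each statement's English description precedes it below -/
import Mathlib

section
/- Let 1 ≤ k < n, let t ∈ ℂ with t ≠ 0, and let S be a set of k distinct complex numbers with z^n = (−1)^{k−1}t for every z ∈ S. Then V_S is totally nonnegative if and only if t is a positive real number and S = {t^{1/n}·z : z ∈ S₀}, where t^{1/n} denotes the positive real n-th root of t. -/
open scoped BigOperators

/-- The `t`-deformed left cyclic shift map on `ℂⁿ`:
`σ_t(v₁,…,vₙ) = (v₂,…,vₙ,(−1)^{k−1} t v₁)`. -/
noncomputable def cycShift (k n : ℕ) (t : ℂ) : (Fin n → ℂ) →ₗ[ℂ] (Fin n → ℂ) where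
  toFun v := fun i =>
    if h : (i : ℕ) + 1 < n then v ⟨(i : ℕ) + 1, h⟩ else (-1 : ℂ) ^ (k - 1) * t * v ⟨0, i.pos⟩
  map_add' u v := by
    funext i
    by_cases h : (i : ℕ) + 1 < n <;> simp [h, mul_add]
  map_smul' c v := by
    funext i
    by_cases h : (i : ℕ) + 1 < n <;> simp [h, mul_comm, mul_left_comm, mul_assoc]

/-- `V_S`: the span in `ℂⁿ` of the vectors `(1, z, …, z^{n-1})` for `z ∈ S`. -/
noncomputable def VS (n : ℕ) (S : Finset ℂ) : Submodule ℂ (Fin n → ℂ) :=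
  Submodule.span ℂ ((fun z : ℂ => fun j : Fin n => z ^ (j : ℕ)) '' (S : Set ℂ))

/-- `S₀`: the `k` n-th roots of `(−1)^{k−1}` closest to `1` on the unit circle. -/
noncomputable def S0 (k n : ℕ) : Finset ℂ :=
  Finset.image
    (fun j : Fin k => Complex.exp (Complex.I * ((2 * (j : ℝ) + 1 - k) * Real.pi / n)))
    Finset.univ

/-- The rows of a real `k × n` matrix, viewed as vectors in `ℂⁿ`. -/
def rowsC {k n : ℕ} (A : Matrix (Fin k) (Fin n) ℝ) : Fin k → (Fin n → ℂ) :=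
  fun p j => (A p j : ℂ)

/-- A subspace `V ⊆ ℂⁿ` is totally nonnegative if it has a basis given by the rows
of a real `k × n` matrix all of whose `k × k` minors (columns in increasing order)
are nonnegative. -/
def IsTotallyNonneg (k n : ℕ) (V : Submodule ℂ (Fin n → ℂ)) : Prop :=
  ∃ A : Matrix (Fin k) (Fin n) ℝ,
    LinearIndependent ℂ (rowsC A) ∧
    Submodule.span ℂ (Set.range (rowsC A)) = V ∧
    ∀ g : Fin k → Fin n, StrictMono g → 0 ≤ (A.submatrix id g).det

/-- Totally positive subspaces: as above but with strictly positive minors. -/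
def IsTotallyPos (k n : ℕ) (V : Submodule ℂ (Fin n → ℂ)) : Prop :=
  ∃ A : Matrix (Fin k) (Fin n) ℝ,
    LinearIndependent ℂ (rowsC A) ∧
    Submodule.span ℂ (Set.range (rowsC A)) = V ∧
    ∀ g : Fin k → Fin n, StrictMono g → 0 < (A.submatrix id g).det

open Matrix in
/-- A Cauchy–Binet formula, with the sum over all (not only increasing) column selections. -/
theorem sum_det_submatrix_mul_det_submatrix {R : Type*} [CommRing R] {k n : ℕ}
    (A B : Matrix (Fin k) (Fin n) R) :
    ∑ g : Fin k → Fin n, (A.submatrix id g).det * (B.submatrix id g).det =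
      (k.factorial : R) * (A * Bᵀ).det := by
  have expand (C : Matrix (Fin k) (Fin n) R) :
      (A * Cᵀ).det = ∑ g : Fin k → Fin n, (A.submatrix id g).det * ∏ i, C i (g i) := by
    simp only [det_apply', mul_apply, Finset.prod_univ_sum, Finset.mul_sum,
      Fintype.piFinset_univ, Finset.sum_mul, transpose_apply, submatrix_apply, id]
    rw [Finset.sum_comm]
    refine Finset.sum_congr rfl fun g _ => Finset.sum_congr rfl fun σ _ => ?_
    rw [Finset.prod_mul_distrib, mul_assoc]
  have key (σ : Equiv.Perm (Fin k)) :
      (A * Bᵀ).det = (Equiv.Perm.sign σ : R) * (A * (B.submatrix σ id)ᵀ).det := by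
    have h : A * (B.submatrix σ id)ᵀ = (A * Bᵀ).submatrix id σ := by
      ext i j
      simp [mul_apply]
    rw [h, det_permute', ← mul_assoc]
    rcases Int.units_eq_one_or (Equiv.Perm.sign σ) with h | h <;> simp [h]
  calc _ = ∑ σ : Equiv.Perm (Fin k),
        (Equiv.Perm.sign σ : R) * (A * (B.submatrix σ id)ᵀ).det := by
        simp only [expand, Finset.mul_sum]
        rw [Finset.sum_comm]
        refine Finset.sum_congr rfl fun g _ => ?_
        rw [det_apply' (B.submatrix id g), Finset.mul_sum]
        refine Finset.sum_congr rfl fun σ _ => ?_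
        simp only [submatrix_apply, id]
        ring
    _ = _ := by
        simp only [← key, Finset.sum_const, Finset.card_univ, Fintype.card_perm, Fintype.card_fin,
          nsmul_eq_mul]

open Matrix in
/-- If the maximal minors of `A` are nonnegative and not all zero and those of `B` are positive,
then `A * Bᵀ` is nonsingular. -/
theorem det_mul_transpose_ne_zero {k n : ℕ} {A B : Matrix (Fin k) (Fin n) ℝ}
    (hA : ∀ g : Fin k → Fin n, StrictMono g → 0 ≤ (A.submatrix id g).det)
    (hB : ∀ g : Fin k → Fin n, StrictMono g → 0 < (B.submatrix id g).det)
    {g₀ : Fin k → Fin n} (hg₀ : StrictMono g₀) (h₀ : (A.submatrix id g₀).det ≠ 0) :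
    (A * Bᵀ).det ≠ 0 := by
  have hpos : 0 < ∑ g : Fin k → Fin n, (A.submatrix id g).det * (B.submatrix id g).det := by
    refine Finset.sum_pos' (fun g _ => ?_)
      ⟨g₀, Finset.mem_univ _, mul_pos ((hA _ hg₀).lt_of_ne' h₀) (hB _ hg₀)⟩
    by_cases hg : Function.Injective g
    · have hm : StrictMono (g ∘ Tuple.sort g) :=
        (Tuple.monotone_sort g).strictMono_of_injective (hg.comp (Tuple.sort g).injective)
      have h1 := hA _ hm
      have h2 := (hB _ hm).le
      have hs (C : Matrix (Fin k) (Fin n) ℝ) : (C.submatrix id (g ∘ Tuple.sort g)).det =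
          (Equiv.Perm.sign (Tuple.sort g) : ℝ) * (C.submatrix id g).det := by
        rw [← det_permute']; rfl
      rw [hs] at h1 h2
      have h := mul_nonneg h1 h2
      rcases Int.units_eq_one_or (Equiv.Perm.sign (Tuple.sort g)) with e | e <;>
        simpa [e] using h
    · obtain ⟨i, j, hij, hne⟩ : ∃ i j, g i = g j ∧ i ≠ j := by
        simpa [Function.Injective] using hg
      rw [det_zero_of_column_eq (M := A.submatrix id g) hne (by simp [hij]), zero_mul]
  intro h
  rw [sum_det_submatrix_mul_det_submatrix, h, mul_zero] at hpos
  exact lt_irrefl _ hpos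

/-- The generalized Vandermonde determinant with nodes `z` and exponents `g`. -/
noncomputable def expDet {k : ℕ} (z : Fin k → ℂ) (g : Fin k → ℕ) : ℂ :=
  (Matrix.of fun i j => z i ^ g j).det

theorem expDet_val_ne_zero {k : ℕ} {z : Fin k → ℂ} (hz : Function.Injective z) :
    expDet z (fun j => (j : ℕ)) ≠ 0 :=
  Matrix.det_vandermonde_ne_zero_iff.2 hz

theorem expDet_add_one {k : ℕ} (z : Fin k → ℂ) (g : Fin k → ℕ) :
    expDet z (fun j => g j + 1) = (∏ i, z i) * expDet z g := by
  rw [expDet, expDet, ← Matrix.det_mul_column]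
  congr 1
  ext i j
  simp [pow_succ']

/-- If all nodes are `n`-th roots of `(-1)^(k-1) t`, cyclically rotating the exponents
multiplies the generalized Vandermonde determinant by `t`. -/
theorem expDet_rotate {m n : ℕ} {z : Fin (m + 1) → ℂ} {t : ℂ}
    (hz : ∀ i, z i ^ n = (-1 : ℂ) ^ m * t) {g h : Fin (m + 1) → ℕ}
    (hlast : g (Fin.last m) = n) (hzero : h 0 = 0) (hgh : ∀ i : Fin m, h i.succ = g i.castSucc) :
    expDet z g = t * expDet z h := by
  have key : (Matrix.of fun i j => z i ^ g j) =
      Matrix.of fun i j => (if j = Fin.last m then (-1 : ℂ) ^ m * t else 1) *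
        ((Matrix.of fun i j => z i ^ h j).submatrix id (finRotate (m + 1))) i j := by
    ext i j
    refine Fin.lastCases ?_ (fun j => ?_) j
    · simp [hlast, hzero, hz]
    · simp [hgh, (Fin.castSucc_lt_last j).ne]
  rw [expDet, key, Matrix.det_mul_row, Matrix.det_permute', sign_finRotate, expDet]
  have h1 : ((-1 : ℂ) ^ m) * (-1) ^ m = 1 := by rw [← mul_pow]; simp
  simp only [Finset.prod_ite_eq', Finset.mem_univ, if_true]
  push_cast
  linear_combination (t * (Matrix.of fun i j => z i ^ h j).det) * h1

/-- The points of `r • S₀` listed in counterclockwise order. -/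
noncomputable def scaledNode (k n : ℕ) (r : ℝ) (j : Fin k) : ℂ :=
  (r : ℂ) * Complex.exp (Complex.I * ((2 * (j : ℝ) + 1 - k) * Real.pi / n))

theorem image_S0_eq (k n : ℕ) (r : ℝ) :
    (S0 k n).image (fun z => (r : ℂ) * z) = Finset.univ.image (scaledNode k n r) := by
  rw [S0, Finset.image_image]
  rfl

theorem expDet_scaledNode {k n : ℕ} (hn : n ≠ 0) (r : ℝ) (g : Fin k → ℕ) :
    expDet (scaledNode k n r) g =
      (∏ i : Fin k, ∏ _j ∈ Finset.Ioi i, Complex.I) *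
        (((∏ i, r ^ g i) * ∏ i : Fin k, ∏ j ∈ Finset.Ioi i,
          2 * Real.sin (((g j : ℝ) - g i) * Real.pi / n) : ℝ) : ℂ) := by
  have hn' : (n : ℂ) ≠ 0 := by exact_mod_cast hn
  set F : Fin k → ℂ := fun j => Complex.exp (Complex.I * (g j * Real.pi / n)) with hF
  have h1 : (Matrix.of fun i j => scaledNode k n r i ^ g j) =
      Matrix.of fun i j => ((r : ℂ) ^ g j * Complex.exp (Complex.I * ((1 - k) * Real.pi / n)) ^ g j)
        * (Matrix.vandermonde fun j => F j ^ 2).transpose i j := by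
    ext i j
    simp only [scaledNode, hF, Matrix.of_apply, Matrix.transpose_apply, Matrix.vandermonde_apply,
      mul_pow, ← Complex.exp_nat_mul, mul_assoc, ← Complex.exp_add]
    congr 2
    push_cast
    field_simp
    ring
  have h2 (i j : Fin k) : F j ^ 2 - F i ^ 2 = F j * F i * (Complex.I *
      ((2 * Real.sin (((g j : ℝ) - g i) * Real.pi / n) : ℝ) : ℂ)) := by
    have e (x y : ℂ) : Complex.exp (Complex.I * x) ^ 2 - Complex.exp (Complex.I * y) ^ 2 =
        Complex.exp (Complex.I * x) * Complex.exp (Complex.I * y) *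
          (Complex.I * (2 * Complex.sin (x - y))) := by
      have h3 : Complex.exp (Complex.I * x) * Complex.exp (Complex.I * y) *
          Complex.exp ((x - y) * Complex.I) = Complex.exp (Complex.I * x) ^ 2 := by
        rw [← Complex.exp_add, ← Complex.exp_add, ← Complex.exp_nat_mul]
        congr 1; push_cast; ring
      have h4 : Complex.exp (Complex.I * x) * Complex.exp (Complex.I * y) *
          Complex.exp (-(x - y) * Complex.I) = Complex.exp (Complex.I * y) ^ 2 := by
        rw [← Complex.exp_add, ← Complex.exp_add, ← Complex.exp_nat_mul]
        congr 1; push_cast; ring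
      rw [Complex.sin, ← h3, ← h4]
      linear_combination Complex.exp (Complex.I * x) * Complex.exp (Complex.I * y) *
        (Complex.exp ((x - y) * Complex.I) - Complex.exp (-(x - y) * Complex.I)) * Complex.I_mul_I
    push_cast
    rw [sub_mul, sub_div]
    exact e _ _
  have h5 : ∏ i : Fin k, ∏ j ∈ Finset.Ioi i, F i * F j = ∏ i, F i ^ (k - 1) := by
    rw [Finset.prod_prod_Ioi_mul_eq_prod_prod_off_diag (fun _ b => F b)]
    refine Finset.prod_congr rfl fun i _ => ?_
    simp [Finset.card_compl]
  have h6 (i : Fin k) :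
      Complex.exp (Complex.I * ((1 - k) * Real.pi / n)) ^ g i * F i ^ (k - 1) = 1 := by
    rw [hF, ← Complex.exp_nat_mul, ← Complex.exp_nat_mul, ← Complex.exp_add,
      Nat.cast_sub (Nat.one_le_of_lt i.2)]
    refine Eq.trans (congrArg Complex.exp ?_) Complex.exp_zero
    push_cast
    ring
  rw [expDet, h1, Matrix.det_mul_row, Matrix.det_transpose, Matrix.det_vandermonde]
  simp only [h2]
  simp only [Finset.prod_mul_distrib] at h5 ⊢
  have h7 : (∏ i, Complex.exp (Complex.I * ((1 - k) * Real.pi / n)) ^ g i) *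
      ∏ i, F i ^ (k - 1) = 1 := by
    rw [← Finset.prod_mul_distrib]
    exact Finset.prod_eq_one fun i _ => h6 i
  rw [← h5] at h7
  push_cast
  simp only [Finset.prod_mul_distrib]
  linear_combination (∏ i, (r : ℂ) ^ g i) * (∏ i : Fin k, ∏ _j ∈ Finset.Ioi i, Complex.I) *
    ((∏ i : Fin k, ∏ _j ∈ Finset.Ioi i, (2 : ℂ)) * ∏ i : Fin k, ∏ j ∈ Finset.Ioi i,
      Complex.sin (((g j : ℂ) - g i) * Real.pi / n)) * h7

theorem prod_sin_pos {k n : ℕ} {r : ℝ} (hr : 0 < r) {g : Fin k → ℕ} (hg : StrictMono g)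
    (hgn : ∀ i, g i < n) :
    0 < (∏ i, r ^ g i) * ∏ i : Fin k, ∏ j ∈ Finset.Ioi i,
      2 * Real.sin (((g j : ℝ) - g i) * Real.pi / n) := by
  refine mul_pos (Finset.prod_pos fun i _ => pow_pos hr _)
    (Finset.prod_pos fun i _ => Finset.prod_pos fun j hj => ?_)
  have hij : (g i : ℝ) < g j := by exact_mod_cast hg (Finset.mem_Ioi.1 hj)
  have hjn : (g j : ℝ) < n := by exact_mod_cast hgn j
  have hi : (0 : ℝ) ≤ g i := by positivity
  have hn : (0 : ℝ) < n := by linarith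
  refine mul_pos two_pos (Real.sin_pos_of_pos_of_lt_pi ?_ ?_)
  · exact div_pos (mul_pos (by linarith) Real.pi_pos) hn
  · rw [div_lt_iff₀ hn, mul_comm]
    exact mul_lt_mul_of_pos_left (by linarith) Real.pi_pos

/-- The `k × n` matrix whose rows are the moment vectors of the nodes `z`. -/
noncomputable def momentMatrix {k : ℕ} (n : ℕ) (z : Fin k → ℂ) : Matrix (Fin k) (Fin n) ℂ :=
  Matrix.of fun i j => z i ^ (j : ℕ)

theorem det_momentMatrix_submatrix {k n : ℕ} (z : Fin k → ℂ) (g : Fin k → Fin n) :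
    ((momentMatrix n z).submatrix id g).det = expDet z (fun j => (g j : ℕ)) :=
  rfl

theorem VS_image_univ {k n : ℕ} (z : Fin k → ℂ) :
    VS n (Finset.univ.image z) = Submodule.span ℂ (Set.range (momentMatrix n z)) := by
  rw [VS, Finset.coe_image, Finset.coe_univ, Set.image_univ, ← Set.range_comp]
  rfl

theorem span_range_mul_le {k n : ℕ} (P : Matrix (Fin k) (Fin k) ℂ) (M : Matrix (Fin k) (Fin n) ℂ) :
    Submodule.span ℂ (Set.range (P * M)) ≤ Submodule.span ℂ (Set.range M) := by
  rw [Submodule.span_le]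
  rintro _ ⟨i, rfl⟩
  rw [Matrix.mul_apply_eq_vecMul, Matrix.vecMul_eq_sum]
  exact Submodule.sum_mem _ fun j _ => Submodule.smul_mem _ _
    (Submodule.subset_span (Set.mem_range_self j))

theorem exists_mul_eq_of_span_le {k n : ℕ} {M A : Matrix (Fin k) (Fin n) ℂ}
    (h : Submodule.span ℂ (Set.range M) ≤ Submodule.span ℂ (Set.range A)) :
    ∃ Q : Matrix (Fin k) (Fin k) ℂ, Q * A = M := by
  have (i : Fin k) : ∃ c : Fin k → ℂ, ∑ j, c j • A j = M i :=
    (Submodule.mem_span_range_iff_exists_fun ℂ).1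
      (h (Submodule.subset_span (Set.mem_range_self i)))
  choose Q hQ using this
  refine ⟨Matrix.of Q, ?_⟩
  funext i
  rw [← hQ]
  exact (Matrix.mul_apply_eq_vecMul (Matrix.of Q) A i).trans (Matrix.vecMul_eq_sum _ _)

open Matrix in
/-- `V_{r S₀}` is spanned by the rows of a real matrix with positive maximal minors. -/
theorem exists_real_matrix {k n : ℕ} (hkn : k ≤ n) (hn : n ≠ 0) {r : ℝ} (hr : 0 < r) :
    ∃ B : Matrix (Fin k) (Fin n) ℝ, ∃ P : Matrix (Fin k) (Fin k) ℂ,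
      IsUnit P.det ∧ rowsC B = P * momentMatrix n (scaledNode k n r) ∧
      ∀ g : Fin k → Fin n, StrictMono g → 0 < (B.submatrix id g).det := by
  set M := momentMatrix n (scaledNode k n r) with hM
  set R : (Fin k → Fin n) → ℝ := fun g => (∏ i, r ^ (g i : ℕ)) *
    ∏ i : Fin k, ∏ j ∈ Finset.Ioi i, 2 * Real.sin ((((g j : ℕ) : ℝ) - (g i : ℕ)) * Real.pi / n)
    with hR
  set C : ℂ := ∏ i : Fin k, ∏ _j ∈ Finset.Ioi i, Complex.I with hC
  have hC0 : C ≠ 0 :=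
    Finset.prod_ne_zero_iff.2 fun i _ => Finset.prod_ne_zero_iff.2 fun j _ => Complex.I_ne_zero
  have hdet (g : Fin k → Fin n) : (M.submatrix id g).det = C * (R g : ℂ) := by
    rw [hM, det_momentMatrix_submatrix, expDet_scaledNode hn]
  have hpos (g : Fin k → Fin n) (hg : StrictMono g) : 0 < R g :=
    prod_sin_pos hr (g := fun i => (g i : ℕ)) (fun _ _ h => hg h) fun i => (g i).2
  set l : Fin k → Fin n := Fin.castLE hkn with hl
  have hl0 : (R l : ℂ) ≠ 0 := by exact_mod_cast (hpos l (Fin.strictMono_castLE hkn)).ne'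
  set M₀ := M.submatrix id l with hM₀
  have hM₀det : M₀.det ≠ 0 := by rw [hM₀, hdet]; exact mul_ne_zero hC0 hl0
  set B : Matrix (Fin k) (Fin n) ℝ := of fun i j => R (Function.update l i j) / R l with hB
  have hBM : rowsC B = M₀⁻¹ * M := by
    funext i j
    have h1 : (M₀⁻¹ * M) i j = M₀.det⁻¹ * cramer M₀ (fun p => M p j) i := by
      rw [cramer_eq_adjugate_mulVec, Matrix.inv_def, Matrix.smul_mul, Matrix.smul_apply,
        Ring.inverse_eq_inv', smul_eq_mul]
      rfl
    have h2 : M₀.updateCol i (fun p => M p j) = M.submatrix id (Function.update l i j) := by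
      ext p q
      by_cases h : q = i
      · subst h; simp
      · simp [h, hM₀]
    rw [h1, cramer_apply, h2, hM₀, hdet, hdet]
    simp only [rowsC, hB, of_apply, Complex.ofReal_div]
    field_simp
  refine ⟨B, M₀⁻¹, ?_, hBM, fun g hg => ?_⟩
  · exact (Matrix.isUnit_nonsing_inv_det _ (isUnit_iff_ne_zero.2 hM₀det))
  · have h1 : (((B.submatrix id g).det : ℝ) : ℂ) = ((R g / R l : ℝ) : ℂ) := by
      have h2 : (((B.submatrix id g).det : ℝ) : ℂ) = (M₀⁻¹ * M.submatrix id g).det := by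
        rw [show M₀⁻¹ * M.submatrix id g = (M₀⁻¹ * M).submatrix id g from rfl, ← hBM]
        exact RingHom.map_det Complex.ofRealHom _
      rw [h2, det_mul, det_nonsing_inv, Ring.inverse_eq_inv', hM₀, hdet, hdet]
      push_cast
      field_simp
    rw [Complex.ofReal_inj.1 h1]
    exact div_pos (hpos g hg) (hpos l (Fin.strictMono_castLE hkn))

theorem rowsC_eq_of_span_le {k n : ℕ} {z : Fin k → ℂ} {A : Matrix (Fin k) (Fin n) ℝ}
    (h : VS n (Finset.univ.image z) ≤ Submodule.span ℂ (Set.range (rowsC A))) :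
    ∃ Q : Matrix (Fin k) (Fin k) ℂ, Q * A.map Complex.ofReal = momentMatrix n z := by
  rw [VS_image_univ] at h
  exact exists_mul_eq_of_span_le h

/-- The proportionality of the maximal minors of two matrices with the same row span. -/
theorem expDet_eq_det_mul {k n : ℕ} {z : Fin k → ℂ} {A : Matrix (Fin k) (Fin n) ℝ}
    {Q : Matrix (Fin k) (Fin k) ℂ} (hQ : Q * A.map Complex.ofReal = momentMatrix n z)
    (g : Fin k → Fin n) :
    expDet z (fun j => (g j : ℕ)) = Q.det * ((A.submatrix id g).det : ℝ) := by
  rw [← det_momentMatrix_submatrix, ← hQ,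
    show (Q * A.map Complex.ofReal).submatrix id g =
      Q * (A.submatrix id g).map Complex.ofReal from rfl, Matrix.det_mul]
  congr 1
  exact (RingHom.map_det Complex.ofRealHom _).symm

theorem isTotallyNonneg_VS_scaledNode {k n : ℕ} (hkn : k ≤ n) (hn : n ≠ 0) {r : ℝ} (hr : 0 < r) :
    IsTotallyNonneg k n (VS n (Finset.univ.image (scaledNode k n r))) := by
  obtain ⟨B, P, hP, hBP, hpos⟩ := exists_real_matrix hkn hn hr
  refine ⟨B, ?_, ?_, fun g hg => (hpos g hg).le⟩
  · rw [Fintype.linearIndependent_iff]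
    intro c hc
    have h0 : ((B.submatrix id (Fin.castLE hkn)).map Complex.ofReal).det ≠ 0 := by
      have := (hpos _ (Fin.strictMono_castLE hkn)).ne'
      rw [show ((B.submatrix id (Fin.castLE hkn)).map Complex.ofReal).det =
        ((B.submatrix id (Fin.castLE hkn)).det : ℝ) from (RingHom.map_det Complex.ofRealHom _).symm]
      exact_mod_cast this
    refine congrFun (Matrix.eq_zero_of_vecMul_eq_zero h0 (funext fun j => ?_))
    simpa [rowsC, Matrix.vecMul, dotProduct] using congrFun hc (Fin.castLE hkn j)
  · rw [VS_image_univ]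
    refine le_antisymm (hBP ▸ span_range_mul_le _ _) ?_
    have h : momentMatrix n (scaledNode k n r) = P⁻¹ * (Matrix.of (rowsC B)) := by
      rw [show Matrix.of (rowsC B) = P * momentMatrix n (scaledNode k n r) from hBP, ← Matrix.mul_assoc, Matrix.nonsing_inv_mul _ hP, Matrix.one_mul]
    conv_lhs => rw [h]
    exact span_range_mul_le _ _

theorem pos_of_isTotallyNonneg {m n : ℕ} (hmn : m + 1 < n) {z : Fin (m + 1) → ℂ}
    (hz : Function.Injective z) {t : ℂ} (ht : t ≠ 0) (hroots : ∀ i, z i ^ n = (-1 : ℂ) ^ m * t)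
    {A : Matrix (Fin (m + 1)) (Fin n) ℝ} {Q : Matrix (Fin (m + 1)) (Fin (m + 1)) ℂ}
    (hQ : Q * A.map Complex.ofReal = momentMatrix n z)
    (hA : ∀ g : Fin (m + 1) → Fin n, StrictMono g → 0 ≤ (A.submatrix id g).det) :
    ∃ u : ℝ, 0 < u ∧ t = u := by
  have hz0 (i) : z i ≠ 0 := by
    intro h
    have := hroots i
    rw [h, zero_pow (by omega)] at this
    exact mul_ne_zero (pow_ne_zero _ (by norm_num)) ht this.symm
  set p : ℂ := ∏ i, z i with hp
  have hp0 : p ≠ 0 := Finset.prod_ne_zero_iff.2 fun i _ => hz0 i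
  set first : Fin (m + 1) → Fin n := fun i => ⟨i, by omega⟩
  set second : Fin (m + 1) → Fin n := fun i => ⟨i + 1, by omega⟩
  set final : Fin (m + 1) → Fin n := fun i => ⟨n - (m + 1) + i, by omega⟩
  set wrapped : Fin (m + 1) → Fin n :=
    fun i => if (i : ℕ) = 0 then ⟨0, by omega⟩ else ⟨n - (m + 1) + i, by omega⟩
  have e1 : expDet z (fun j => (first j : ℕ)) ≠ 0 := expDet_val_ne_zero hz
  have e2 : expDet z (fun j => (second j : ℕ)) = p * expDet z (fun j => (first j : ℕ)) :=
    expDet_add_one z _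
  have shift (c : ℕ) : expDet z (fun j => c + (j : ℕ)) ≠ 0 := by
    induction c with
    | zero => simpa using expDet_val_ne_zero hz
    | succ c ih =>
      have := expDet_add_one z (fun j => c + (j : ℕ))
      simp only [Nat.add_right_comm c _ 1] at this
      rw [this]
      exact mul_ne_zero hp0 ih
  have e3 : expDet z (fun j => (final j : ℕ)) ≠ 0 := shift _
  have e4 : p * expDet z (fun j => (final j : ℕ)) = t * expDet z (fun j => (wrapped j : ℕ)) := by
    rw [← expDet_add_one]
    refine expDet_rotate hroots ?_ ?_ fun i => ?_
    · simp [final]; omega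
    · simp [wrapped]
    · simp [final, wrapped]; omega
  have first_mono : StrictMono first := fun i j h => h
  have second_mono : StrictMono second := fun i j h => Nat.succ_lt_succ h
  have final_mono : StrictMono final := fun i j h => Nat.add_lt_add_left h _
  have wrapped_mono : StrictMono wrapped := by
    intro i j h
    have h' : (i : ℕ) < j := h
    simp only [wrapped, Fin.lt_def]
    split_ifs <;> simp <;> omega
  rw [expDet_eq_det_mul hQ] at e1 e3
  simp only [expDet_eq_det_mul hQ] at e2 e4
  have hq : Q.det ≠ 0 := left_ne_zero_of_mul e1
  have hfirst := (hA _ first_mono).lt_of_ne' (by simpa [hq] using e1)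
  have hfinal := (hA _ final_mono).lt_of_ne' (by simpa [hq] using e3)
  have hsecond := hA _ second_mono
  have hwrapped := hA _ wrapped_mono
  set a := (A.submatrix id first).det
  set b := (A.submatrix id second).det
  set c := (A.submatrix id final).det
  set d := (A.submatrix id wrapped).det
  have f2 : (b : ℂ) = p * a := mul_left_cancel₀ hq (by linear_combination e2)
  have f4 : p * c = t * d := mul_left_cancel₀ hq (by linear_combination e4)
  have ha : (a : ℂ) ≠ 0 := by exact_mod_cast hfirst.ne'
  have hc : (c : ℂ) ≠ 0 := by exact_mod_cast hfinal.ne'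
  have hd : (d : ℂ) ≠ 0 := by
    intro h
    rw [h, mul_zero] at f4
    exact mul_ne_zero hp0 hc f4
  have hb : (b : ℂ) ≠ 0 := by rw [f2]; exact mul_ne_zero hp0 ha
  have hb' := hsecond.lt_of_ne' (by exact_mod_cast hb)
  have hd' := hwrapped.lt_of_ne' (by exact_mod_cast hd)
  refine ⟨b * c / (a * d), by positivity, ?_⟩
  push_cast
  rw [eq_div_iff (mul_ne_zero ha hd), f2]
  linear_combination -(a : ℂ) * f4

theorem scaledNode_mul_rev {k n : ℕ} (r : ℝ) (hr : r ≠ 0) (j : Fin k) :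
    scaledNode k n r j.rev * scaledNode k n r⁻¹ j = 1 := by
  have hr' : (r : ℂ) ≠ 0 := by exact_mod_cast hr
  have hj : ((j.rev : ℕ) : ℂ) = k - 1 - (j : ℕ) := by
    rw [Fin.val_rev, Nat.cast_sub (by omega)]
    push_cast
    ring
  simp only [scaledNode]
  rw [mul_mul_mul_comm, ← Complex.exp_add]
  push_cast
  rw [mul_inv_cancel₀ hr', one_mul]
  refine Eq.trans (congrArg Complex.exp ?_) Complex.exp_zero
  rw [hj]
  ring

theorem scaledNode_pow {k n : ℕ} (hk : 1 ≤ k) (hn : n ≠ 0) (r : ℝ) (j : Fin k) :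
    scaledNode k n r j ^ n = (-1 : ℂ) ^ (k - 1) * (r : ℂ) ^ n := by
  have hn' : (n : ℂ) ≠ 0 := by exact_mod_cast hn
  obtain ⟨m, rfl⟩ : ∃ m, k = m + 1 := ⟨k - 1, by omega⟩
  rw [scaledNode, mul_pow, ← Complex.exp_nat_mul, mul_comm, Nat.add_sub_cancel]
  congr 1
  have h : (n : ℂ) * (Complex.I * ((2 * ((j : ℕ) : ℝ) + 1 - ((m + 1 : ℕ) : ℂ)) * Real.pi / n)) =
      ((j : ℕ) : ℂ) * (2 * Real.pi * Complex.I) + (m : ℕ) * -(Real.pi * Complex.I) := by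
    push_cast
    field_simp
    ring
  rw [h, Complex.exp_add, Complex.exp_nat_mul_two_pi_mul_I, one_mul, Complex.exp_nat_mul,
    Complex.exp_neg, Complex.exp_pi_mul_I]
  norm_num

open Matrix in
/-- Every node of a totally nonnegative `V_S` is a node of the totally positive one, since
otherwise its moment vector would be orthogonal to a totally positive subspace. -/
theorem mem_range_scaledNode {k n : ℕ} (hk : 1 ≤ k) (hkn : k < n) {z : Fin k → ℂ}
    (hz : Function.Injective z) {r : ℝ} (hr : 0 < r)
    (hroots : ∀ i, z i ^ n = (-1 : ℂ) ^ (k - 1) * (r : ℂ) ^ n)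
    {A : Matrix (Fin k) (Fin n) ℝ} {Q : Matrix (Fin k) (Fin k) ℂ}
    (hQ : Q * A.map Complex.ofReal = momentMatrix n z)
    (hA : ∀ g : Fin k → Fin n, StrictMono g → 0 ≤ (A.submatrix id g).det) (i : Fin k) :
    z i ∈ Set.range (scaledNode k n r) := by
  by_contra hi
  have hn : n ≠ 0 := by omega
  have hr' : (r : ℂ) ≠ 0 := by exact_mod_cast hr.ne'
  obtain ⟨B, P, -, hBP, hB⟩ := exists_real_matrix hkn.le hn (inv_pos.2 hr)
  have horth (j : Fin k) :
      ∑ l : Fin n, z i ^ (l : ℕ) * scaledNode k n r⁻¹ j ^ (l : ℕ) = 0 := by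
    have hne : z i * scaledNode k n r⁻¹ j ≠ 1 := by
      intro h
      refine hi ⟨j.rev, ?_⟩
      have h2 := scaledNode_mul_rev (n := n) r hr.ne' j
      refine mul_right_cancel₀ (right_ne_zero_of_mul_eq_one h) (h2.trans h.symm)
    simp only [← mul_pow]
    rw [Fin.sum_univ_eq_sum_range (fun l => (z i * scaledNode k n r⁻¹ j) ^ l), geom_sum_eq hne,
      mul_pow, hroots, scaledNode_pow hk hn]
    have h1 : ((-1 : ℂ) ^ (k - 1)) * (-1) ^ (k - 1) = 1 := by rw [← mul_pow]; simp
    push_cast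
    rw [mul_mul_mul_comm, h1, ← mul_pow, mul_inv_cancel₀ hr']
    simp
  have hfirst : expDet z (fun j => ((Fin.castLE hkn.le j : Fin n) : ℕ)) ≠ 0 :=
    expDet_val_ne_zero hz
  rw [expDet_eq_det_mul hQ] at hfirst
  have hdet := det_mul_transpose_ne_zero hA hB (Fin.strictMono_castLE hkn.le)
    (by exact_mod_cast right_ne_zero_of_mul hfirst)
  have hgram : Q * (A * Bᵀ).map Complex.ofReal = momentMatrix n z *
      (momentMatrix n (scaledNode k n r⁻¹))ᵀ * Pᵀ := by
    have h1 : (A * Bᵀ).map Complex.ofReal =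
        A.map Complex.ofReal * (B.map Complex.ofReal)ᵀ := by
      ext p q
      simp [Matrix.mul_apply]
    rw [h1, ← Matrix.mul_assoc, hQ, Matrix.mul_assoc, ← Matrix.transpose_mul, ← hBP]
    rfl
  have hzero : (Q * (A * Bᵀ).map Complex.ofReal).det = 0 := by
    rw [hgram, det_mul, det_eq_zero_of_row_eq_zero i, zero_mul]
    intro j
    rw [Matrix.mul_apply]
    exact horth j
  rw [det_mul] at hzero
  refine mul_ne_zero (left_ne_zero_of_mul hfirst) ?_ hzero
  rw [show ((A * Bᵀ).map Complex.ofReal).det = ((A * Bᵀ).det : ℝ) from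
    (RingHom.map_det Complex.ofRealHom _).symm]
  exact_mod_cast hdet

/-- for `1 ≤ k < n`, `t ≠ 0` and `S` a `k`-element set of `n`-th roots of
`(−1)^{k−1}t`, the subspace `V_S` is totally nonnegative iff `t` is a positive real `u`
and `S = u^{1/n} · S₀` (positive real `n`-th root). -/
theorem VS_tnn_iff (k n : ℕ) (hk : 1 ≤ k) (hkn : k < n) (t : ℂ) (ht : t ≠ 0)
    (S : Finset ℂ) (hS : S.card = k)
    (hroots : ∀ z ∈ S, z ^ n = (-1 : ℂ) ^ (k - 1) * t) :
    IsTotallyNonneg k n (VS n S) ↔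
      ∃ u : ℝ, 0 < u ∧ t = (u : ℂ) ∧
        S = (S0 k n).image fun z => ((u ^ (1 / (n : ℝ)) : ℝ) : ℂ) * z := by
  have hn : n ≠ 0 := by omega
  constructor
  · rintro ⟨A, -, hspan, hA⟩
    set z : Fin k → ℂ := fun i => ((S.equivFinOfCardEq hS).symm i : ℂ) with hz
    have hinj : Function.Injective z :=
      Subtype.val_injective.comp (S.equivFinOfCardEq hS).symm.injective
    have hzS (i : Fin k) : z i ∈ S := ((S.equivFinOfCardEq hS).symm i).2
    have himage : Finset.univ.image z = S := by
      refine Finset.eq_of_subset_of_card_le (Finset.image_subset_iff.2 fun i _ => hzS i) ?_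
      rw [Finset.card_image_of_injective _ hinj, hS, Finset.card_univ, Fintype.card_fin]
    obtain ⟨Q, hQ⟩ := rowsC_eq_of_span_le (z := z) (A := A) (by rw [himage, hspan])
    obtain ⟨u, hu, rfl⟩ : ∃ u : ℝ, 0 < u ∧ t = u := by
      obtain ⟨m, rfl⟩ : ∃ m, k = m + 1 := ⟨k - 1, by omega⟩
      exact pos_of_isTotallyNonneg hkn hinj ht (fun i => hroots _ (hzS i)) hQ hA
    refine ⟨u, hu, rfl, ?_⟩
    have hr : 0 < u ^ (1 / (n : ℝ)) := Real.rpow_pos_of_pos hu _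
    have hpow : ((u ^ (1 / (n : ℝ)) : ℝ) : ℂ) ^ n = u := by
      rw [one_div]
      exact_mod_cast Real.rpow_inv_natCast_pow hu.le hn
    rw [image_S0_eq]
    refine Finset.eq_of_subset_of_card_le (fun w hw => ?_)
      (Finset.card_image_le.trans (by simp [hS]))
    rw [← himage, Finset.mem_image] at hw
    obtain ⟨i, -, rfl⟩ := hw
    obtain ⟨j, hj⟩ := mem_range_scaledNode hk hkn hinj hr
      (fun i => (hroots _ (hzS i)).trans (by rw [hpow])) hQ hA i
    exact Finset.mem_image.2 ⟨j, Finset.mem_univ _, hj⟩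
  · rintro ⟨u, hu, -, rfl⟩
    rw [image_S0_eq]
    exact isTotallyNonneg_VS_scaledNode hkn.le hn (Real.rpow_pos_of_pos hu _)
end

section
/- Let 1 ≤ k ≤ n and let z₁,…,z_k be distinct nonzero complex numbers with z₁ⁿ = z₂ⁿ = … = z_kⁿ. Then the set {v ∈ ℂⁿ : ⟨v, c_s⟩ = 0 for all s = k+1,…,n}, where c_s denotes the s-th column of the Toeplitz matrix u_{k,n}(z₁,…,z_k), equals V_{{z₁,…,z_k}}. -/
open scoped BigOperators

/-- The `j`-th elementary symmetric polynomial evaluated at `z : Fin k → ℂ`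
(it vanishes automatically for `j > k`). -/
noncomputable def esym (k : ℕ) (z : Fin k → ℂ) (j : ℕ) : ℂ :=
  ∑ T ∈ Finset.powersetCard j (Finset.univ : Finset (Fin k)), ∏ r ∈ T, z r

/-- The Toeplitz matrix `u_{k,n}(z₁,…,z_k)` with `(r,s)`-entry `e_{s−r}(z₁,…,z_k)`
(and `0` below the diagonal, i.e. for `s − r < 0`). -/
noncomputable def toeplitzU (k n : ℕ) (z : Fin k → ℂ) : Matrix (Fin n) (Fin n) ℂ :=
  Matrix.of fun r s : Fin n =>
    if (r : ℕ) ≤ (s : ℕ) then esym k z ((s : ℕ) - (r : ℕ)) else 0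

/-- `∑ₘ (-a)^(N-m) eₘ(z) = 0` when `a` is one of the `z_r` and `N ≥ k`. -/
lemma sum_neg_pow_mul_esym_eq_zero (k : ℕ) (z : Fin k → ℂ) (r : Fin k) (hr : z r ≠ 0)
    {N : ℕ} (hN : k ≤ N) :
    ∑ m ∈ Finset.range (N + 1), (-z r) ^ (N - m) * esym k z m = 0 := by
  have hprod : ∏ i : Fin k, (1 + z i / (-z r)) = 0 :=
    Finset.prod_eq_zero (Finset.mem_univ r) (by field_simp; ring)
  have hsum : ∑ m ∈ Finset.range (k + 1), (1 / (-z r)) ^ m * esym k z m = 0 := by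
    rw [Finset.prod_one_add, Finset.sum_powerset, Finset.card_univ, Fintype.card_fin] at hprod
    rw [← hprod]
    refine Finset.sum_congr rfl fun m _ => ?_
    rw [esym, Finset.mul_sum]
    refine Finset.sum_congr rfl fun T hT => ?_
    rw [Finset.prod_div_distrib, Finset.prod_const, (Finset.mem_powersetCard.mp hT).2,
      one_div, inv_pow, inv_mul_eq_div]
  have hext : ∑ m ∈ Finset.range (N + 1), (1 / (-z r)) ^ m * esym k z m = 0 := by
    rw [← hsum]
    symm
    refine Finset.sum_subset (Finset.range_subset_range.mpr (by omega)) fun m _ hm => ?_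
    rw [esym, Finset.powersetCard_eq_empty.mpr, Finset.sum_empty, mul_zero]
    simpa using hm
  calc ∑ m ∈ Finset.range (N + 1), (-z r) ^ (N - m) * esym k z m
      = (-z r) ^ N * ∑ m ∈ Finset.range (N + 1), (1 / (-z r)) ^ m * esym k z m := by
        rw [Finset.mul_sum]
        refine Finset.sum_congr rfl fun m hm => ?_
        rw [pow_sub₀ _ (neg_ne_zero.mpr hr) (Nat.lt_succ_iff.mp (Finset.mem_range.mp hm)),
          one_div, inv_pow, mul_assoc]
    _ = 0 := by rw [hext, mul_zero]

/-- The vector `(1, z_r, …, z_r^{n-1})` is orthogonal to the last `n - k` columns. -/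
lemma sum_pow_mul_toeplitzU_eq_zero (k n : ℕ) (z : Fin k → ℂ) (r : Fin k) (hr : z r ≠ 0)
    (s : Fin n) (hs : k ≤ (s : ℕ)) :
    ∑ j : Fin n, (-1 : ℂ) ^ (j : ℕ) * z r ^ (j : ℕ) * toeplitzU k n z j s = 0 := by
  have hN := sum_neg_pow_mul_esym_eq_zero k z r hr hs
  rw [← Finset.sum_range_reflect] at hN
  simp only [toeplitzU, Matrix.of_apply]
  rw [Fin.sum_univ_eq_sum_range
    (fun j => (-1 : ℂ) ^ j * z r ^ j * if j ≤ (s : ℕ) then esym k z (s - j) else 0) n]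
  refine (Eq.symm ?_).trans hN
  refine Finset.sum_subset_zero_on_sdiff (Finset.range_subset_range.mpr (by omega)) (fun j hj => ?_)
    fun j hj => ?_
  · have : ¬ j ≤ (s : ℕ) := by simp at hj; omega
    simp [this]
  · have hj' : j ≤ (s : ℕ) := by simp at hj; omega
    rw [if_pos hj', ← mul_pow, neg_one_mul]
    congr 2
    omega

/-- A vector orthogonal to the last `n - k` columns whose first `k` entries vanish is zero. -/
lemma eq_zero_of_orth_toeplitzU (k n : ℕ) (z : Fin k → ℂ) (v : Fin n → ℂ)
    (hv : ∀ s : Fin n, k ≤ (s : ℕ) →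
      ∑ j : Fin n, (-1 : ℂ) ^ (j : ℕ) * v j * toeplitzU k n z j s = 0)
    (h0 : ∀ j : Fin n, (j : ℕ) < k → v j = 0) : v = 0 := by
  funext s
  induction s using WellFoundedLT.induction with
  | ind s ih =>
    by_cases hs : (s : ℕ) < k
    · exact h0 s hs
    · have h := hv s (not_lt.mp hs)
      rw [Finset.sum_eq_single s (fun j _ hj => ?_) (by simp)] at h
      · simpa [toeplitzU, esym] using h
      · rcases lt_or_gt_of_ne hj with hlt | hgt
        · simp [ih j hlt]
        · simp [toeplitzU, hgt]

/-- A combination of powers of distinct `z_r` can interpolate any `k` prescribed values. -/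
lemma exists_sum_mul_pow_eq (k : ℕ) (z : Fin k → ℂ) (hinj : Function.Injective z)
    (w : Fin k → ℂ) : ∃ c : Fin k → ℂ, ∀ j : Fin k, ∑ r, c r * z r ^ (j : ℕ) = w j := by
  have hdet : IsUnit (Matrix.vandermonde z) :=
    (Matrix.isUnit_iff_isUnit_det _).mpr (Matrix.det_vandermonde_ne_zero_iff.mpr hinj).isUnit
  obtain ⟨c, hc⟩ := Matrix.vecMul_surjective_iff_isUnit.mpr hdet w
  exact ⟨c, fun j => by simpa [Matrix.vecMul, dotProduct] using congrFun hc j⟩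

/-- for distinct nonzero `z₁,…,z_k` with `z₁ⁿ = ⋯ = z_kⁿ`, the set of
vectors `⟨·,·⟩`-orthogonal to the last `n − k` columns of `u_{k,n}(z₁,…,z_k)`
equals `V_{{z₁,…,z_k}}`. -/
theorem orth_toeplitz_eq_VS (k n : ℕ) (hk : 1 ≤ k) (hkn : k ≤ n)
    (z : Fin k → ℂ) (hinj : Function.Injective z) (hz : ∀ r, z r ≠ 0)
    (hpow : ∀ r s, z r ^ n = z s ^ n) :
    {v : Fin n → ℂ | ∀ s : Fin n, k ≤ (s : ℕ) →
        ∑ j : Fin n, (-1 : ℂ) ^ (j : ℕ) * v j * toeplitzU k n z j s = 0}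
      = (VS n (Finset.image z Finset.univ) : Set (Fin n → ℂ)) := by
  ext v
  simp only [Set.mem_ofPred_eq, SetLike.mem_coe]
  have hmem : ∀ u ∈ VS n (Finset.image z Finset.univ), ∀ s : Fin n, k ≤ (s : ℕ) →
      ∑ j : Fin n, (-1 : ℂ) ^ (j : ℕ) * u j * toeplitzU k n z j s = 0 := by
    intro u hu s hs
    induction hu using Submodule.span_induction with
    | mem x hx =>
      obtain ⟨a, ha, rfl⟩ := hx
      obtain ⟨r, rfl⟩ : ∃ r, z r = a := by simpa using ha
      exact sum_pow_mul_toeplitzU_eq_zero k n z r (hz r) s hs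
    | zero => simp
    | add x y _ _ hx hy => simp [mul_add, add_mul, Finset.sum_add_distrib, hx, hy]
    | smul a x _ hx =>
      rw [← mul_zero a, ← hx, Finset.mul_sum]
      refine Finset.sum_congr rfl fun j _ => ?_
      simp only [Pi.smul_apply, smul_eq_mul]
      ring
  refine ⟨fun hv => ?_, fun hv => hmem v hv⟩
  obtain ⟨c, hc⟩ := exists_sum_mul_pow_eq k z hinj fun j => v (Fin.castLE hkn j)
  set u : Fin n → ℂ := ∑ r, c r • fun j : Fin n => z r ^ (j : ℕ) with hu
  have huV : u ∈ VS n (Finset.image z Finset.univ) :=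
    Submodule.sum_mem _ fun r _ => Submodule.smul_mem _ _
      (Submodule.subset_span ⟨z r, by simp, rfl⟩)
  have hsub : v - u = 0 := by
    refine eq_zero_of_orth_toeplitzU k n z _ (fun s hs => ?_) fun j hj => ?_
    · simp only [Pi.sub_apply, mul_sub, sub_mul, Finset.sum_sub_distrib]
      rw [hv s hs, hmem u huV s hs, sub_zero]
    · have := hc ⟨j, hj⟩
      simp only [Fin.castLE_mk, Fin.eta] at this
      simp [hu, Finset.sum_apply, this]
  rwa [sub_eq_zero.mp hsub]
end

section
/- Let 1 ≤ k ≤ n, let λ = (λ₁ ≥ λ₂ ≥ … ≥ λ_k ≥ 0) be a partition with λ₁ ≤ n−k, and set z_j := e^{i(2j−1−k)π/n} for j = 1,…,k. Then det((z_r)^{λ_{k+1−s}+s−1})_{1≤r,s≤k} = (∏_{1≤r<s≤k} sin((λ_r−λ_s+s−r)π/n) / sin((s−r)π/n)) · det((z_r)^{s−1})_{1≤r,s≤k}. -/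
open scoped BigOperators

theorem Fin.prod_prod_Ioi_mul {M : Type*} [CommMonoid M] {k : ℕ} (f : Fin k → M) :
    ∏ r : Fin k, ∏ s ∈ Finset.Ioi r, (f r * f s) = ∏ s : Fin k, f s ^ (k - 1) := by
  have hswap : ∏ r : Fin k, ∏ s ∈ Finset.Ioi r, f s = ∏ s : Fin k, ∏ r ∈ Finset.Iio s, f s :=
    Finset.prod_comm' (by simp)
  simp_rw [Finset.prod_mul_distrib]
  rw [hswap, ← Finset.prod_mul_distrib]
  refine Finset.prod_congr rfl fun s _ => ?_
  rw [Finset.prod_const, Finset.prod_const, Fin.card_Ioi, Fin.card_Iio, ← pow_add]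
  congr 1
  omega

/-- The Vandermonde determinant in the squares of units, with the columns rescaled so that the
exponents are symmetric about zero. -/
theorem det_pow_sq_mul_inv_pow {K : Type*} [Field K] {k : ℕ} (f : Fin k → K)
    (hf : ∀ s, f s ≠ 0) :
    (Matrix.of fun r s : Fin k => (f s ^ (k - 1))⁻¹ * (f s ^ 2) ^ (r : ℕ)).det =
      ∏ r : Fin k, ∏ s ∈ Finset.Ioi r, (f s / f r - f r / f s) := by
  have h := Matrix.det_mul_row (fun s => (f s ^ (k - 1))⁻¹)
    (Matrix.vandermonde fun s => f s ^ 2).transpose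
  simp only [Matrix.transpose_apply, Matrix.vandermonde_apply] at h
  rw [h, Matrix.det_transpose, Matrix.det_vandermonde, Finset.prod_inv_distrib,
    ← Fin.prod_prod_Ioi_mul, ← Finset.prod_inv_distrib, ← Finset.prod_mul_distrib]
  refine Finset.prod_congr rfl fun r _ => ?_
  rw [← Finset.prod_inv_distrib, ← Finset.prod_mul_distrib]
  refine Finset.prod_congr rfl fun s _ => ?_
  have hr := hf r
  have hs := hf s
  field_simp

theorem Complex.exp_div_exp_sub_exp_div_exp (x y : ℝ) :
    Complex.exp (Complex.I * y) / Complex.exp (Complex.I * x)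
        - Complex.exp (Complex.I * x) / Complex.exp (Complex.I * y) =
      2 * Complex.I * (Real.sin (y - x) : ℂ) := by
  rw [← Complex.exp_sub, ← Complex.exp_sub, Complex.ofReal_sin, Complex.sin]
  have h₁ : -((y - x : ℝ) : ℂ) * Complex.I = Complex.I * x - Complex.I * y := by
    push_cast; ring
  have h₂ : ((y - x : ℝ) : ℂ) * Complex.I = Complex.I * y - Complex.I * x := by
    push_cast; ring
  rw [h₁, h₂]
  linear_combination (Complex.exp (Complex.I * y - Complex.I * x)
    - Complex.exp (Complex.I * x - Complex.I * y)) * Complex.I_mul_I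

theorem det_pow_rootsOfUnity_eq_prod_sin (k n : ℕ) (a : Fin k → ℕ) (z : Fin k → ℂ)
    (hz : ∀ j : Fin k, z j =
      Complex.exp (Complex.I * ((2 * ((j : ℕ) : ℝ) + 1 - k) * Real.pi / n))) :
    (Matrix.of fun r s : Fin k => z r ^ a s).det =
      ∏ r : Fin k, ∏ s ∈ Finset.Ioi r,
        (2 * Complex.I * (Real.sin (((a s : ℝ) - a r) * Real.pi / n) : ℂ)) := by
  have h := det_pow_sq_mul_inv_pow
    (fun s : Fin k => Complex.exp (Complex.I * ((a s * Real.pi / n : ℝ) : ℂ)))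
    (fun s => Complex.exp_ne_zero _)
  simp only [Complex.exp_div_exp_sub_exp_div_exp] at h
  have hsub (r s : Fin k) : (a s : ℝ) * Real.pi / n - a r * Real.pi / n =
      ((a s : ℝ) - a r) * Real.pi / n := by ring
  simp only [hsub] at h
  rw [← h]
  congr 1
  ext r s
  simp only [Matrix.of_apply]
  rw [hz, ← Complex.exp_nat_mul, ← Complex.exp_nat_mul, ← Complex.exp_nat_mul,
    ← Complex.exp_nat_mul, ← Complex.exp_neg, ← Complex.exp_add]
  have hk : ((k - 1 : ℕ) : ℂ) = k - 1 := by
    rw [Nat.cast_sub (by have := r.2; omega), Nat.cast_one]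
  rw [hk]
  push_cast
  congr 1
  ring

theorem Fin.prod_prod_Ioi_rev {M : Type*} [CommMonoid M] {k : ℕ} (f : Fin k → Fin k → M) :
    ∏ r : Fin k, ∏ s ∈ Finset.Ioi r, f s.rev r.rev = ∏ r : Fin k, ∏ s ∈ Finset.Ioi r, f r s := by
  rw [Finset.prod_sigma', Finset.prod_sigma']
  refine Finset.prod_nbij' (fun p => ⟨p.2.rev, p.1.rev⟩) (fun p => ⟨p.2.rev, p.1.rev⟩)
    ?_ ?_ ?_ ?_ ?_ <;> simp

/-- for `z_j = e^{i(2j−1−k)π/n}` and a partition `λ ∈ P_{k,n}`, the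
bialternant determinant `det((z_r)^{λ_{k+1−s}+s−1})` equals
`(∏_{r<s} sin((λ_r−λ_s+s−r)π/n)/sin((s−r)π/n))` times the Vandermonde determinant
`det((z_r)^{s−1})`. -/
theorem bialternant_at_S0 (k n : ℕ) (hk : 1 ≤ k) (hkn : k ≤ n)
    (lam : Fin k → ℕ) (hlam : Antitone lam) (hbound : ∀ j, lam j ≤ n - k)
    (z : Fin k → ℂ)
    (hz : ∀ j : Fin k, z j =
      Complex.exp (Complex.I * ((2 * ((j : ℕ) : ℝ) + 1 - k) * Real.pi / n))) :
    (Matrix.of fun r s : Fin k => z r ^ (lam s.rev + (s : ℕ))).det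
      = (↑(∏ r : Fin k, ∏ s ∈ Finset.Ioi r,
            Real.sin ((((lam r : ℕ) : ℝ) - ((lam s : ℕ) : ℝ) + ((s : ℕ) : ℝ) - ((r : ℕ) : ℝ))
                * Real.pi / n) /
              Real.sin ((((s : ℕ) : ℝ) - ((r : ℕ) : ℝ)) * Real.pi / n)) : ℂ) *
          (Matrix.of fun r s : Fin k => z r ^ (s : ℕ)).det := by
  have hrev := Fin.prod_prod_Ioi_rev fun r s : Fin k =>
    2 * Complex.I * (Real.sin (((lam r : ℝ) - lam s + ((s : ℕ) : ℝ) - ((r : ℕ) : ℝ))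
      * Real.pi / n) : ℂ)
  rw [det_pow_rootsOfUnity_eq_prod_sin k n _ z hz, det_pow_rootsOfUnity_eq_prod_sin k n _ z hz]
  trans ∏ r : Fin k, ∏ s ∈ Finset.Ioi r, 2 * Complex.I *
    (Real.sin (((lam r : ℝ) - lam s + ((s : ℕ) : ℝ) - ((r : ℕ) : ℝ)) * Real.pi / n) : ℂ)
  · rw [← hrev]
    refine Finset.prod_congr rfl fun r _ => Finset.prod_congr rfl fun s _ => ?_
    congr 4
    rw [Fin.val_rev, Fin.val_rev, Nat.cast_sub (by omega), Nat.cast_sub (by omega)]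
    push_cast
    ring
  · push_cast
    rw [← Finset.prod_mul_distrib]
    refine Finset.prod_congr rfl fun r _ => ?_
    rw [← Finset.prod_mul_distrib]
    refine Finset.prod_congr rfl fun s hs => ?_
    have hrs : (r : ℕ) < s := Fin.lt_def.1 (Finset.mem_Ioi.1 hs)
    have hsn : ((s : ℕ) : ℝ) < n := by exact_mod_cast s.2.trans_le hkn
    have hpos : (0 : ℝ) < ((s : ℕ) : ℝ) - ((r : ℕ) : ℝ) := sub_pos.2 (by exact_mod_cast hrs)
    have hr : (0 : ℝ) ≤ ((r : ℕ) : ℝ) := Nat.cast_nonneg _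
    have hn : (0 : ℝ) < n := by linarith
    have hsin : Real.sin ((((s : ℕ) : ℝ) - ((r : ℕ) : ℝ)) * Real.pi / n) ≠ 0 := by
      refine (Real.sin_pos_of_pos_of_lt_pi (by positivity) ?_).ne'
      rw [div_lt_iff₀ hn, mul_comm]
      exact mul_lt_mul_of_pos_left (by linarith) Real.pi_pos
    have hsin' := Complex.ofReal_ne_zero.2 hsin
    push_cast at hsin'
    rw [mul_left_comm, div_mul_cancel₀ _ hsin']
end

section
/- (Rietsch) Let 1 ≤ k < n, let t ∈ ℂ with t ≠ 0, and let z₁,…,z_k be distinct complex numbers with z_jⁿ = (−1)^{k−1}t for all j. Then s_λ(z₁,…,z_k) is a nonnegative real number for every λ ∈ P_{k,n} if and only if t is a positive real number and {z₁,…,z_k} = {t^{1/n}·e^{i(2j−1−k)π/n} : j = 1,…,k}, where t^{1/n} is the positive real n-th root of t. In that case, s_λ(z₁,…,z_k) = t^{|λ|/n} · ∏_{1≤r<s≤k} sin((λ_r−λ_s+s−r)π/n) / sin((s−r)π/n) for every λ ∈ P_{k,n}, where |λ| = λ₁+…+λ_k. -/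
open scoped BigOperators

/-- The Schur polynomial value `s_λ(z₁,…,z_k)` as a bialternant ratio. -/
noncomputable def schurValue (k : ℕ) (lam : Fin k → ℕ) (z : Fin k → ℂ) : ℂ :=
  (Matrix.of fun r s : Fin k => z r ^ (lam s.rev + (s : ℕ))).det /
    (Matrix.of fun r s : Fin k => z r ^ (s : ℕ)).det

section Alternant

variable {R : Type*} [CommRing R] {k n : ℕ}

/-- The alternant `det (x_r ^ (f s))`. -/
def alternant (x : Fin k → R) (f : Fin k → ℕ) : R :=
  (Matrix.of fun r s : Fin k => x r ^ f s).det

theorem alternant_comp_perm (x : Fin k → R) (f : Fin k → ℕ) (σ : Equiv.Perm (Fin k)) :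
    alternant x (f ∘ σ) = (Equiv.Perm.sign σ : ℤ) * alternant x f :=
  Matrix.det_permute' σ (Matrix.of fun r s : Fin k => x r ^ f s)

theorem alternant_perm_comp (x : Fin k → R) (f : Fin k → ℕ) (σ : Equiv.Perm (Fin k)) :
    alternant (x ∘ σ) f = (Equiv.Perm.sign σ : ℤ) * alternant x f :=
  Matrix.det_permute σ (Matrix.of fun r s : Fin k => x r ^ f s)

theorem sign_mul_self_cast (σ : Equiv.Perm (Fin k)) :
    ((Equiv.Perm.sign σ : ℤ) : R) * (Equiv.Perm.sign σ : ℤ) = 1 := by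
  rcases Int.units_eq_one_or (Equiv.Perm.sign σ) with h | h <;> simp [h]

theorem alternant_smul (c : R) (x : Fin k → R) (f : Fin k → ℕ) :
    alternant (fun r => c * x r) f = c ^ (∑ s, f s) * alternant x f := by
  rw [alternant, alternant, ← Finset.prod_pow_eq_pow_sum, ← Matrix.det_mul_row]
  simp only [mul_pow, Matrix.of_apply]

theorem alternant_add_const (x : Fin k → R) (f : Fin k → ℕ) (m : ℕ) :
    alternant x (fun s => f s + m) = (∏ r, x r) ^ m * alternant x f := by
  rw [alternant, alternant, ← Finset.prod_pow, ← Matrix.det_mul_column]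
  simp only [pow_add, Matrix.of_apply, mul_comm]

theorem alternant_eq_zero (x : Fin k → R) {f : Fin k → ℕ} (hf : ¬ Function.Injective f) :
    alternant x f = 0 := by
  obtain ⟨i, j, hij, hne⟩ : ∃ i j, f i = f j ∧ i ≠ j := by
    simpa [Function.Injective] using hf
  exact Matrix.det_zero_of_column_eq hne fun r => by simp [hij]

/-- The Cauchy–Binet formula for alternants, summed over all column choices. -/
theorem sum_alternant_mul_alternant (x y : Fin k → R) :
    ∑ f : Fin k → Fin n, alternant x (fun s => f s) * alternant y (fun s => f s) =
      (Nat.factorial k : R) *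
        (Matrix.of fun r s : Fin k => ∑ j : Fin n, (x r * y s) ^ (j : ℕ)).det := by
  have hdet : (Matrix.of fun r s : Fin k => ∑ j : Fin n, (x r * y s) ^ (j : ℕ)).det =
      ∑ f : Fin k → Fin n, alternant x (fun s => f s) * ∏ i, y i ^ (f i : ℕ) := by
    simp only [alternant, Matrix.det_apply', Matrix.of_apply, Finset.prod_univ_sum,
      Fintype.piFinset_univ, Finset.mul_sum, Finset.sum_mul]
    rw [Finset.sum_comm]
    simp only [mul_pow, Finset.prod_mul_distrib, mul_assoc]
  have hterm : ∀ τ : Equiv.Perm (Fin k),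
      ∑ f : Fin k → Fin n, alternant x (fun s => f s) *
        ((Equiv.Perm.sign τ : ℤ) * ∏ i, y (τ i) ^ (f i : ℕ)) =
      ∑ f : Fin k → Fin n, alternant x (fun s => f s) * ∏ i, y i ^ (f i : ℕ) := by
    intro τ
    refine Fintype.sum_equiv (Equiv.arrowCongr τ (Equiv.refl _)) _ _ fun f => ?_
    have h1 : (fun s => ((Equiv.arrowCongr τ (Equiv.refl (Fin n)) f s : Fin n) : ℕ)) =
        (fun s => (f s : ℕ)) ∘ (τ⁻¹ : Equiv.Perm (Fin k)) := rfl
    have h2 : ∏ i, y i ^ ((Equiv.arrowCongr τ (Equiv.refl (Fin n)) f i : Fin n) : ℕ) =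
        ∏ i, y (τ i) ^ (f i : ℕ) := by
      rw [← Equiv.prod_comp τ]
      simp [Equiv.arrowCongr]
    rw [h1, h2, alternant_comp_perm, Equiv.Perm.sign_inv]
    ring
  calc _ = ∑ τ : Equiv.Perm (Fin k), ∑ f : Fin k → Fin n, alternant x (fun s => f s) *
        ((Equiv.Perm.sign τ : ℤ) * ∏ i, y (τ i) ^ (f i : ℕ)) := by
        rw [Finset.sum_comm]
        refine Finset.sum_congr rfl fun f _ => ?_
        rw [← Finset.mul_sum]
        congr 1
        simp [alternant, Matrix.det_apply']
    _ = _ := by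
        simp only [hterm, hdet, Finset.sum_const, Finset.card_univ, Fintype.card_perm,
          Fintype.card_fin, nsmul_eq_mul]

theorem prod_Ioi_mul (a : Fin k → R) :
    ∏ r : Fin k, ∏ s ∈ Finset.Ioi r, (a s * a r) = ∏ r, a r ^ (k - 1) := by
  have h : ∏ r : Fin k, ∏ s ∈ Finset.Ioi r, a s = ∏ s : Fin k, ∏ _r ∈ Finset.Iio s, a s :=
    Finset.prod_comm' (by simp)
  simp only [Finset.prod_mul_distrib, h, Finset.prod_const, Fin.card_Ioi, Fin.card_Iio]
  rw [← Finset.prod_mul_distrib]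
  refine Finset.prod_congr rfl fun r _ => ?_
  rw [← pow_add]
  congr 1
  omega

end Alternant

section Schur

variable {k n : ℕ}

theorem schurValue_eq_alternant (lam : Fin k → ℕ) (z : Fin k → ℂ) :
    schurValue k lam z =
      alternant z (fun s => lam s.rev + (s : ℕ)) / alternant z (fun s => (s : ℕ)) := rfl

theorem schurValue_eq_alternant_rev (lam : Fin k → ℕ) (z : Fin k → ℂ) :
    schurValue k lam z =
      alternant z (fun s => lam s + (s.rev : ℕ)) / alternant z (fun s => (s.rev : ℕ)) := by
  have h1 := alternant_comp_perm z (fun s => lam s.rev + (s : ℕ)) Fin.revPerm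
  have h2 := alternant_comp_perm z (fun s => (s : ℕ)) Fin.revPerm
  simp only [Function.comp_def, Fin.revPerm_apply, Fin.rev_rev] at h1 h2
  rw [schurValue_eq_alternant, h1, h2, mul_div_mul_left]
  exact left_ne_zero_of_mul_eq_one (sign_mul_self_cast _)

theorem schurValue_comp_perm (lam : Fin k → ℕ) (z : Fin k → ℂ) (σ : Equiv.Perm (Fin k)) :
    schurValue k lam (z ∘ σ) = schurValue k lam z := by
  rw [schurValue_eq_alternant, schurValue_eq_alternant, alternant_perm_comp, alternant_perm_comp,
    mul_div_mul_left]
  exact left_ne_zero_of_mul_eq_one (sign_mul_self_cast _)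

theorem schurValue_smul (lam : Fin k → ℕ) {c : ℂ} (hc : c ≠ 0) (z : Fin k → ℂ) :
    schurValue k lam (fun r => c * z r) = c ^ (∑ j, lam j) * schurValue k lam z := by
  have h : ∑ j : Fin k, lam j.rev = ∑ j, lam j := Equiv.sum_comp Fin.revPerm lam
  rw [schurValue_eq_alternant, schurValue_eq_alternant, alternant_smul, alternant_smul,
    Finset.sum_add_distrib, pow_add, h, mul_assoc, mul_div_assoc, mul_div_mul_left]
  exact pow_ne_zero _ hc

theorem alternant_ne_zero {z : Fin k → ℂ} (hz : Function.Injective z) :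
    alternant z (fun s => (s : ℕ)) ≠ 0 :=
  Matrix.det_vandermonde_ne_zero_iff.2 hz

/-- Increasing exponent sequences below `n` come from partitions in a `k × (n - k)` box. -/
theorem exists_partition_of_strictMono {g : Fin k → ℕ} (hg : StrictMono g) (hgn : ∀ s, g s < n) :
    ∃ lam : Fin k → ℕ, Antitone lam ∧ (∀ j, lam j ≤ n - k) ∧
      ∀ s : Fin k, lam s.rev + (s : ℕ) = g s := by
  have hsub : ∀ a b : Fin k, a ≤ b → g a + b ≤ g b + a := by
    intro a b hab
    obtain ⟨b, hb⟩ := b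
    induction b with
    | zero =>
      have : a = ⟨0, hb⟩ := le_antisymm hab (Nat.zero_le _)
      simp [this]
    | succ b ih =>
      rcases hab.eq_or_lt with rfl | hlt
      · exact le_rfl
      · have h1 := ih (by omega) (Nat.lt_succ_iff.1 hlt)
        have h2 : g ⟨b, by omega⟩ < g ⟨b + 1, hb⟩ := hg (Nat.lt_succ_self b)
        simp only at h1 ⊢
        omega
  have hle : ∀ s : Fin k, (s : ℕ) ≤ g s := fun s => by
    have := hsub ⟨0, s.pos⟩ s (Nat.zero_le _)
    simp only at this
    omega
  refine ⟨fun j => g j.rev - (j.rev : ℕ), fun i j hij => ?_, fun j => ?_, fun s => ?_⟩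
  · have := hsub j.rev i.rev (Fin.rev_le_rev.2 hij)
    have := hle j.rev
    have := hle i.rev
    simp only
    omega
  · have h1 := hsub j.rev ⟨k - 1, by have := j.pos; omega⟩ (by
      rw [Fin.le_def]; simp only [Fin.val_rev]; omega)
    have h2 := hgn ⟨k - 1, by have := j.pos; omega⟩
    have := hle j.rev
    have := j.pos
    simp only at h1 ⊢
    omega
  · have := hle s
    simp only [Fin.rev_rev]
    omega

end Schur

section Roots

variable {k n : ℕ}

/-- The `n`-th roots of `(-1)^(k-1)` closest to `1`, listed by increasing argument. -/
noncomputable def centralRoot (k n : ℕ) (j : Fin k) : ℂ :=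
  Complex.exp (Complex.I * ((2 * (j : ℝ) + 1 - k) * Real.pi / n))

theorem mem_S0 {w : ℂ} : w ∈ S0 k n ↔ ∃ j, centralRoot k n j = w := by
  simp [S0, centralRoot]

theorem centralRoot_pow (hn : n ≠ 0) (j : Fin k) : centralRoot k n j ^ n = (-1) ^ (k - 1) := by
  have hn' : (n : ℂ) ≠ 0 := by exact_mod_cast hn
  have hk : ((k - 1 : ℕ) : ℂ) = k - 1 := by
    rw [Nat.cast_sub j.pos, Nat.cast_one]
  have h : (n : ℂ) * (Complex.I * ((2 * ((j : ℝ) : ℂ) + 1 - k) * Real.pi / n)) =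
      (j : ℕ) * (2 * Real.pi * Complex.I) - (k - 1 : ℕ) * (Real.pi * Complex.I) := by
    rw [hk]
    push_cast
    field_simp
    ring
  rw [centralRoot, ← Complex.exp_nat_mul, h, Complex.exp_sub, Complex.exp_nat_mul_two_pi_mul_I,
    Complex.exp_nat_mul, Complex.exp_pi_mul_I, one_div, ← inv_pow]
  norm_num

theorem centralRoot_mul_rev (j : Fin k) : centralRoot k n j * centralRoot k n j.rev = 1 := by
  have hj : ((j.rev : ℕ) : ℂ) = k - 1 - j := by
    rw [Fin.val_rev, Nat.cast_sub (by omega)]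
    push_cast
    ring
  rw [centralRoot, centralRoot, ← Complex.exp_add, Complex.exp_eq_one_iff]
  refine ⟨0, ?_⟩
  push_cast
  rw [hj]
  ring

theorem alternant_centralRoot (hn : n ≠ 0) (f : Fin k → ℕ) :
    alternant (centralRoot k n) f = ∏ r : Fin k, ∏ s ∈ Finset.Ioi r,
      (2 * Complex.I * Complex.sin (((f s : ℂ) - f r) * Real.pi / n)) := by
  have hn' : (n : ℂ) ≠ 0 := by exact_mod_cast hn
  set e : Fin k → ℂ := fun s => Complex.exp (Complex.I * (f s * Real.pi / n)) with he
  have he0 : ∀ s, e s ≠ 0 := fun s => Complex.exp_ne_zero _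
  have hentry : ∀ r s : Fin k, centralRoot k n r ^ f s =
      (e s ^ (k - 1))⁻¹ * (e s ^ 2) ^ (r : ℕ) := by
    intro r s
    have hk : ((k - 1 : ℕ) : ℂ) = k - 1 := by
      rw [Nat.cast_sub r.pos, Nat.cast_one]
    simp only [he, centralRoot]
    rw [← Complex.exp_nat_mul, ← Complex.exp_nat_mul, ← Complex.exp_neg, ← pow_mul,
      ← Complex.exp_nat_mul, ← Complex.exp_add, hk]
    congr 1
    push_cast
    ring
  have hsin : ∀ r s : Fin k, e s ^ 2 - e r ^ 2 =
      (e s * e r) * (2 * Complex.I * Complex.sin (((f s : ℂ) - f r) * Real.pi / n)) := by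
    intro r s
    have h : ((f s : ℂ) - f r) * Real.pi / n * Complex.I =
        Complex.I * (f s * Real.pi / n) - Complex.I * (f r * Real.pi / n) := by ring
    have h2 : 2 * Complex.I * Complex.sin (((f s : ℂ) - f r) * Real.pi / n) =
        e s / e r - e r / e s := by
      rw [Complex.sin, neg_mul, h, neg_sub, Complex.exp_sub, Complex.exp_sub]
      linear_combination -(e s / e r - e r / e s) * Complex.I_mul_I
    rw [h2]
    have := he0 r
    have := he0 s
    field_simp
  have hV : (Matrix.of fun r s : Fin k => (e s ^ 2) ^ (r : ℕ)).det =
      ∏ r : Fin k, ∏ s ∈ Finset.Ioi r, (e s ^ 2 - e r ^ 2) := by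
    rw [← Matrix.det_vandermonde, ← Matrix.det_transpose (Matrix.vandermonde _)]
    rfl
  have hM : (Matrix.of fun r s : Fin k => centralRoot k n r ^ f s) =
      Matrix.of fun r s : Fin k => (e s ^ (k - 1))⁻¹ *
        (Matrix.of fun r s : Fin k => (e s ^ 2) ^ (r : ℕ)) r s := by
    ext r s
    exact hentry r s
  rw [alternant, hM, Matrix.det_mul_row (fun s => (e s ^ (k - 1))⁻¹), hV]
  simp only [hsin, Finset.prod_mul_distrib (f := fun s => e s * e _)]
  rw [Finset.prod_mul_distrib, prod_Ioi_mul, ← mul_assoc, ← Finset.prod_mul_distrib]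
  rw [Finset.prod_eq_one (fun s _ => inv_mul_cancel₀ (pow_ne_zero _ (he0 s))), one_mul]

theorem sin_mul_pi_div_pos {x : ℝ} (h0 : 0 < x) (hx : x < n) : 0 < Real.sin (x * Real.pi / n) := by
  have hn : (0 : ℝ) < n := h0.trans hx
  refine Real.sin_pos_of_pos_of_lt_pi (by positivity) ?_
  rw [div_lt_iff₀ hn, mul_comm]
  exact mul_lt_mul_of_pos_left hx Real.pi_pos

theorem schurValue_centralRoot (hkn : k < n) (lam : Fin k → ℕ) :
    schurValue k lam (centralRoot k n) = (↑(∏ r : Fin k, ∏ s ∈ Finset.Ioi r,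
      Real.sin ((((lam r : ℕ) : ℝ) - ((lam s : ℕ) : ℝ)
            + ((s : ℕ) : ℝ) - ((r : ℕ) : ℝ)) * Real.pi / n) /
        Real.sin ((((s : ℕ) : ℝ) - ((r : ℕ) : ℝ)) * Real.pi / n)) : ℂ) := by
  have hn : n ≠ 0 := by omega
  rw [schurValue_eq_alternant_rev, alternant_centralRoot hn, alternant_centralRoot hn,
    ← Finset.prod_div_distrib, Complex.ofReal_prod]
  refine Finset.prod_congr rfl fun r _ => ?_
  rw [← Finset.prod_div_distrib, Complex.ofReal_prod]
  refine Finset.prod_congr rfl fun s _ => ?_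
  have hrev : ∀ j : Fin k, ((j.rev : ℕ) : ℂ) = k - 1 - j := fun j => by
    rw [Fin.val_rev, Nat.cast_sub (by omega)]
    push_cast
    ring
  have h1 : (((lam s + (s.rev : ℕ) : ℕ) : ℂ) - ((lam r + (r.rev : ℕ) : ℕ) : ℂ)) * Real.pi / n =
      -(((lam r : ℂ) - lam s + (s : ℕ) - (r : ℕ)) * Real.pi / n) := by
    push_cast
    rw [hrev, hrev]
    ring
  have h2 : (((s.rev : ℕ) : ℂ) - ((r.rev : ℕ) : ℂ)) * Real.pi / n =
      -((((s : ℕ) : ℂ) - (r : ℕ)) * Real.pi / n) := by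
    rw [hrev, hrev]
    ring
  rw [h1, h2, mul_div_mul_left _ _ (by simp [Complex.I_ne_zero]), Complex.sin_neg, Complex.sin_neg,
    neg_div_neg_eq]
  push_cast
  rfl

theorem prod_sin_div_sin_nonneg (hkn : k < n) {lam : Fin k → ℕ} (hlam : Antitone lam)
    (hle : ∀ j, lam j ≤ n - k) :
    0 ≤ ∏ r : Fin k, ∏ s ∈ Finset.Ioi r,
      Real.sin ((((lam r : ℕ) : ℝ) - ((lam s : ℕ) : ℝ)
            + ((s : ℕ) : ℝ) - ((r : ℕ) : ℝ)) * Real.pi / n) /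
        Real.sin ((((s : ℕ) : ℝ) - ((r : ℕ) : ℝ)) * Real.pi / n) := by
  refine Finset.prod_nonneg fun r _ => Finset.prod_nonneg fun s hs => ?_
  have hrs : (r : ℕ) < s := Fin.lt_def.1 (Finset.mem_Ioi.1 hs)
  have h1 : lam s ≤ lam r := hlam (Finset.mem_Ioi.1 hs).le
  have h2 : lam r + s < n := by have := hle r; have := s.2; omega
  have hrs' : ((r : ℕ) : ℝ) < (s : ℕ) := by exact_mod_cast hrs
  have h1' : (lam s : ℝ) ≤ lam r := by exact_mod_cast h1
  have h2' : (lam r : ℝ) + (s : ℕ) < n := by exact_mod_cast h2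
  have h0 : (0 : ℝ) ≤ lam s := Nat.cast_nonneg _
  have h0' : (0 : ℝ) ≤ (r : ℕ) := Nat.cast_nonneg _
  exact (div_pos (sin_mul_pi_div_pos (by linarith) (by linarith))
    (sin_mul_pi_div_pos (by linarith) (by linarith))).le

theorem alternant_centralRoot_ne_zero (hkn : k < n) :
    alternant (centralRoot k n) (fun s => (s : ℕ)) ≠ 0 := by
  rw [alternant_centralRoot (by omega)]
  refine Finset.prod_ne_zero_iff.2 fun r _ => Finset.prod_ne_zero_iff.2 fun s hs => ?_
  have hrs' : ((r : ℕ) : ℝ) < (s : ℕ) := by exact_mod_cast Fin.lt_def.1 (Finset.mem_Ioi.1 hs)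
  have hs' : ((s : ℕ) : ℝ) < n := by exact_mod_cast s.2.trans hkn
  have h0' : (0 : ℝ) ≤ (r : ℕ) := Nat.cast_nonneg _
  have := (sin_mul_pi_div_pos (n := n) (x := (s : ℕ) - (r : ℕ)) (by linarith) (by linarith)).ne'
  refine mul_ne_zero (by simp [Complex.I_ne_zero]) ?_
  exact_mod_cast this

open scoped ComplexOrder in
/-- Distinct `n`-th roots of `(-1)^(k-1)` with nonnegative Schur values are the central ones. -/
theorem mem_S0_of_schurValue_nonneg (hkn : k < n) {w : Fin k → ℂ} (hw : Function.Injective w)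
    (hroot : ∀ j, w j ^ n = (-1) ^ (k - 1))
    (hpos : ∀ lam : Fin k → ℕ, Antitone lam → (∀ j, lam j ≤ n - k) → 0 ≤ schurValue k lam w)
    (r : Fin k) : w r ∈ S0 k n := by
  by_contra hr
  have hn : n ≠ 0 := by omega
  set V := alternant w (fun s => (s : ℕ)) with hV
  set U := alternant (centralRoot k n) (fun s => (s : ℕ)) with hU
  have hV0 : V ≠ 0 := alternant_ne_zero hw
  have hU0 : U ≠ 0 := alternant_centralRoot_ne_zero hkn
  have hdet : (Matrix.of fun r s : Fin k =>
      ∑ j : Fin n, (w r * centralRoot k n s) ^ (j : ℕ)).det = 0 := by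
    refine Matrix.det_eq_zero_of_row_eq_zero r fun s => ?_
    have hne : w r * centralRoot k n s ≠ 1 := fun h => hr <| mem_S0.2 ⟨s.rev, by
      have h' := centralRoot_mul_rev (n := n) s
      have h0 : centralRoot k n s ≠ 0 := left_ne_zero_of_mul_eq_one h'
      exact mul_left_cancel₀ h0 (by rw [h', mul_comm, h])⟩
    rw [Matrix.of_apply, Fin.sum_univ_eq_sum_range (fun j => (w r * centralRoot k n s) ^ j),
      geom_sum_eq hne, mul_pow, hroot, centralRoot_pow hn, ← mul_pow]
    simp
  have hsum : ∑ f : Fin k → Fin n, alternant w (fun s => f s) / V *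
      (alternant (centralRoot k n) (fun s => f s) / U) = 0 := by
    have h := sum_alternant_mul_alternant (n := n) w (centralRoot k n)
    rw [hdet, mul_zero] at h
    simp only [div_mul_div_comm]
    rw [← Finset.sum_div, h, zero_div]
  have hterm : ∀ f : Fin k → Fin n, 0 ≤ alternant w (fun s => f s) / V *
      (alternant (centralRoot k n) (fun s => f s) / U) := by
    intro f
    by_cases hf : Function.Injective (fun s => (f s : ℕ))
    · set σ := Tuple.sort (fun s => (f s : ℕ))
      have hmono : StrictMono ((fun s => (f s : ℕ)) ∘ σ) :=
        (Tuple.monotone_sort _).strictMono_of_injective (hf.comp σ.injective)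
      obtain ⟨lam, hanti, hle, hlam⟩ :=
        exists_partition_of_strictMono (n := n) hmono fun s => (f (σ s)).2
      have h1 := hpos lam hanti hle
      have h2 : 0 ≤ schurValue k lam (centralRoot k n) := by
        rw [schurValue_centralRoot hkn]
        exact_mod_cast prod_sin_div_sin_nonneg hkn hanti hle
      rw [schurValue_eq_alternant, funext hlam, alternant_comp_perm] at h1 h2
      have h3 := mul_nonneg h1 h2
      rw [div_mul_div_comm, mul_mul_mul_comm, sign_mul_self_cast, one_mul] at h3
      rwa [div_mul_div_comm]
    · rw [alternant_eq_zero w hf]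
      simp
  have h0 := (Finset.sum_eq_zero_iff_of_nonneg fun f _ => hterm f).1 hsum
    (fun s => ⟨s, s.2.trans hkn⟩) (Finset.mem_univ _)
  simp only at h0
  rw [← hV, ← hU, div_self hV0, div_self hU0, mul_one] at h0
  exact one_ne_zero h0

/-- The column partition `1^k` gives the product of the variables. -/
theorem schurValue_one {z : Fin k → ℂ} (hz : Function.Injective z) :
    schurValue k (fun _ => 1) z = ∏ r, z r := by
  have h := alternant_add_const z (fun s => (s : ℕ)) 1
  simp only [add_comm _ 1] at h
  rw [schurValue_eq_alternant]
  simp only [h, pow_one]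
  exact mul_div_cancel_right₀ _ (alternant_ne_zero hz)

/-- Shifting the exponents `0, n-k+1, …, n-1` cyclically evaluates the Schur value of the
partition with `k-1` parts equal to `n-k`. -/
theorem mul_schurValue_rectangle (hk : 1 ≤ k) (hkn : k < n) {t : ℂ} {z : Fin k → ℂ}
    (hz : Function.Injective z) (hroot : ∀ j, z j ^ n = (-1 : ℂ) ^ (k - 1) * t) :
    t * schurValue k (fun j => if (j : ℕ) = k - 1 then 0 else n - k) z =
      (∏ r, z r) ^ (n - k + 1) := by
  obtain ⟨m, rfl⟩ : ∃ m, k = m + 1 := ⟨k - 1, by omega⟩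
  set F : Fin (m + 1) → ℕ := fun s => (s : ℕ) + (n - (m + 1) + 1) with hF
  have h1 : alternant z F = (∏ r, z r) ^ (n - (m + 1) + 1) * alternant z (fun s => (s : ℕ)) :=
    alternant_add_const z _ _
  set G : Fin (m + 1) → ℕ := fun s =>
    (if ((s.rev : Fin (m + 1)) : ℕ) = m + 1 - 1 then 0 else n - (m + 1)) + (s : ℕ) with hG
  have hGrot : alternant z (G ∘ finRotate (m + 1)) = (-1) ^ m * alternant z G := by
    rw [alternant_comp_perm, sign_finRotate]
    simp
  have hcol : alternant z F = (-1) ^ m * t * alternant z (G ∘ finRotate (m + 1)) := by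
    have hprod : ∏ s : Fin (m + 1), (if s = Fin.last m then (-1) ^ m * t else 1) =
        (-1) ^ m * t := by simp
    rw [alternant, alternant, ← hprod, ← Matrix.det_mul_row]
    congr 1
    ext r s
    simp only [Matrix.of_apply, Function.comp_apply]
    split_ifs with h
    · subst h
      have h3 : F (Fin.last m) = n := by
        simp only [hF, Fin.val_last]
        omega
      have h4 : G (finRotate (m + 1) (Fin.last m)) = 0 := by
        simp [hG]
      rw [h3, h4, hroot r]
      simp
    · have h3 := coe_finRotate_of_ne_last h
      have h4 : (s : ℕ) ≠ m := fun h' => h (Fin.ext h')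
      have h5 : G (finRotate (m + 1) s) = F s := by
        simp only [hG, hF, Fin.val_rev, h3]
        rw [if_neg (by omega)]
        omega
      rw [h5, one_mul]
  have hsq : ((-1 : ℂ) ^ m) * (-1) ^ m = 1 := by
    rw [← mul_pow]
    simp
  rw [schurValue_eq_alternant, ← mul_div_assoc, div_eq_iff (alternant_ne_zero hz), ← h1, hcol,
    hGrot]
  linear_combination (-t * alternant z G) * hsq

open scoped ComplexOrder in
theorem pos_of_schurValue_nonneg (hk : 1 ≤ k) (hkn : k < n) {t : ℂ} (ht : t ≠ 0) {z : Fin k → ℂ}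
    (hz : Function.Injective z) (hroot : ∀ j, z j ^ n = (-1 : ℂ) ^ (k - 1) * t)
    (hpos : ∀ lam : Fin k → ℕ, Antitone lam → (∀ j, lam j ≤ n - k) → 0 ≤ schurValue k lam z) :
    0 < t := by
  have hn : n ≠ 0 := by omega
  have hz0 : ∀ j, z j ≠ 0 := fun j h => by
    have := hroot j
    rw [h, zero_pow hn] at this
    simp [ht] at this
  have hP : 0 < ∏ r, z r := by
    refine lt_of_le_of_ne ?_ (Finset.prod_ne_zero_iff.2 fun j _ => hz0 j).symm
    rw [← schurValue_one hz]
    exact hpos _ antitone_const fun _ => by omega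
  have hPn := pow_pos hP (n - k + 1)
  rw [← mul_schurValue_rectangle hk hkn hz hroot] at hPn
  refine pos_of_mul_pos_left hPn (hpos _ (fun i j hij => ?_) fun j => ?_)
  · have := Fin.le_def.1 hij
    have := j.2
    split_ifs <;> omega
  · split_ifs <;> omega

/-- The Schur values at a positive multiple of the central roots. -/
theorem schurValue_of_image_eq {z : Fin k → ℂ} (hz : Function.Injective z)
    {u : ℝ} (hu : 0 < u) (himg : Finset.image z Finset.univ
      = (S0 k n).image fun w => ((u ^ (1 / (n : ℝ)) : ℝ) : ℂ) * w) (lam : Fin k → ℕ) :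
    schurValue k lam z = ((u ^ (((∑ j, lam j : ℕ) : ℝ) / (n : ℝ)) : ℝ) : ℂ) *
      schurValue k lam (centralRoot k n) := by
  have hex : ∀ j, ∃ i, ((u ^ (1 / (n : ℝ)) : ℝ) : ℂ) * centralRoot k n i = z j := by
    intro j
    have hj : z j ∈ Finset.image z Finset.univ := Finset.mem_image_of_mem _ (Finset.mem_univ _)
    rw [himg, Finset.mem_image] at hj
    obtain ⟨w, hw, hwz⟩ := hj
    obtain ⟨i, rfl⟩ := mem_S0.1 hw
    exact ⟨i, hwz⟩
  choose τ hτ using hex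
  have hτinj : Function.Injective τ := fun a b hab => hz (by rw [← hτ a, ← hτ b, hab])
  set σ : Equiv.Perm (Fin k) := Equiv.ofBijective τ (Finite.injective_iff_bijective.1 hτinj) with hσ
  have hzσ : z = (fun r => ((u ^ (1 / (n : ℝ)) : ℝ) : ℂ) * centralRoot k n r) ∘ σ :=
    funext fun j => (hτ j).symm
  have hc : ((u ^ (1 / (n : ℝ)) : ℝ) : ℂ) ≠ 0 := by
    exact_mod_cast (Real.rpow_pos_of_pos hu _).ne'
  rw [hzσ, schurValue_comp_perm, schurValue_smul lam hc, ← Complex.ofReal_pow,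
    ← Real.rpow_natCast, ← Real.rpow_mul hu.le, one_div_mul_eq_div]

open scoped ComplexOrder in
theorem image_eq_of_schurValue_nonneg (hkn : k < n) {z : Fin k → ℂ} (hz : Function.Injective z)
    {u : ℝ} (hu : 0 < u) (hroot : ∀ j, z j ^ n = (-1 : ℂ) ^ (k - 1) * u)
    (hpos : ∀ lam : Fin k → ℕ, Antitone lam → (∀ j, lam j ≤ n - k) → 0 ≤ schurValue k lam z) :
    Finset.image z Finset.univ
      = (S0 k n).image fun w => ((u ^ (1 / (n : ℝ)) : ℝ) : ℂ) * w := by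
  have hn : n ≠ 0 := by omega
  set ρ : ℝ := u ^ (1 / (n : ℝ)) with hρ
  have hρ0 : 0 < ρ := Real.rpow_pos_of_pos hu _
  have hρn : ρ ^ n = u := by
    rw [hρ, one_div]
    exact Real.rpow_inv_natCast_pow hu.le hn
  have hc : (ρ : ℂ)⁻¹ ≠ 0 := by simpa using hρ0.ne'
  have hmem : ∀ j, (ρ : ℂ)⁻¹ * z j ∈ S0 k n := by
    refine mem_S0_of_schurValue_nonneg hkn (fun a b hab => hz (mul_left_cancel₀ hc hab))
      (fun j => ?_) fun lam hanti hle => ?_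
    · have hu' : (u : ℂ) ≠ 0 := by exact_mod_cast hu.ne'
      rw [mul_pow, hroot, inv_pow, ← Complex.ofReal_pow, hρn, mul_left_comm, inv_mul_cancel₀ hu',
        mul_one]
    · rw [schurValue_smul lam hc]
      refine mul_nonneg (pow_nonneg ?_ _) (hpos lam hanti hle)
      rw [← Complex.ofReal_inv]
      exact_mod_cast (inv_pos.2 hρ0).le
  refine Finset.eq_of_subset_of_card_le (fun w hw => ?_) ?_
  · obtain ⟨j, -, rfl⟩ := Finset.mem_image.1 hw
    exact Finset.mem_image.2 ⟨_, hmem j, mul_inv_cancel_left₀ (by simpa using hc) _⟩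
  · rw [Finset.card_image_of_injective _ hz]
    exact Finset.card_image_le.trans Finset.card_image_le

end Roots

/-- Rietsch: for `1 ≤ k < n`, `t ≠ 0`, and `z₁,…,z_k` distinct `n`-th
roots of `(−1)^{k−1}t`: all `s_λ(z₁,…,z_k)`, `λ ∈ P_{k,n}`, are nonnegative reals iff
`t = u > 0` and `{z₁,…,z_k} = u^{1/n}·S₀`; and in that case
`s_λ(z₁,…,z_k) = u^{|λ|/n} ∏_{r<s} sin((λ_r−λ_s+s−r)π/n)/sin((s−r)π/n)`. -/
theorem schur_nonneg_iff (k n : ℕ) (hk : 1 ≤ k) (hkn : k < n) (t : ℂ) (ht : t ≠ 0)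
    (z : Fin k → ℂ) (hinj : Function.Injective z)
    (hroot : ∀ j, z j ^ n = (-1 : ℂ) ^ (k - 1) * t) :
    ((∀ lam : Fin k → ℕ, Antitone lam → (∀ j, lam j ≤ n - k) →
        ∃ c : ℝ, 0 ≤ c ∧ schurValue k lam z = (c : ℂ)) ↔
      (∃ u : ℝ, 0 < u ∧ t = (u : ℂ) ∧
        Finset.image z Finset.univ
          = (S0 k n).image fun w => ((u ^ (1 / (n : ℝ)) : ℝ) : ℂ) * w)) ∧
    (∀ u : ℝ, 0 < u → t = (u : ℂ) →
      Finset.image z Finset.univ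
          = (S0 k n).image (fun w => ((u ^ (1 / (n : ℝ)) : ℝ) : ℂ) * w) →
      ∀ lam : Fin k → ℕ, Antitone lam → (∀ j, lam j ≤ n - k) →
        schurValue k lam z
          = ((u ^ (((∑ j, lam j : ℕ) : ℝ) / (n : ℝ)) : ℝ) : ℂ) *
              (↑(∏ r : Fin k, ∏ s ∈ Finset.Ioi r,
                Real.sin ((((lam r : ℕ) : ℝ) - ((lam s : ℕ) : ℝ)
                      + ((s : ℕ) : ℝ) - ((r : ℕ) : ℝ)) * Real.pi / n) /
                  Real.sin ((((s : ℕ) : ℝ) - ((r : ℕ) : ℝ)) * Real.pi / n)) : ℂ)) := by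
  have hformula := fun (u : ℝ) (hu : 0 < u) himg (lam : Fin k → ℕ) =>
    (schurValue_of_image_eq hinj hu himg lam).trans
      (by rw [schurValue_centralRoot hkn])
  refine ⟨⟨fun h => ?_, ?_⟩, fun u hu _ himg lam _ _ => hformula u hu himg lam⟩
  · open scoped ComplexOrder in
    have hpos : ∀ lam : Fin k → ℕ, Antitone lam → (∀ j, lam j ≤ n - k) →
        0 ≤ schurValue k lam z := fun lam hanti hle => by
      obtain ⟨c, hc, hs⟩ := h lam hanti hle
      rw [hs]
      exact_mod_cast hc
    obtain ⟨u, hu, rfl⟩ : ∃ u : ℝ, 0 < u ∧ t = u := by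
      obtain ⟨hre, him⟩ := Complex.pos_iff.1
        (pos_of_schurValue_nonneg hk hkn ht hinj hroot hpos)
      exact ⟨t.re, hre, Complex.ext rfl (by simp [← him])⟩
    exact ⟨u, hu, rfl, image_eq_of_schurValue_nonneg hkn hinj hu hroot hpos⟩
  · rintro ⟨u, hu, -, himg⟩ lam hanti hle
    exact ⟨_, mul_nonneg (Real.rpow_pos_of_pos hu _).le
      (prod_sin_div_sin_nonneg hkn hanti hle),
      (hformula u hu himg lam).trans (Complex.ofReal_mul _ _).symm⟩
end

section
/- Let 1 ≤ k ≤ n and let z₁,…,z_k be distinct nonzero complex numbers with z₁ⁿ = … = z_kⁿ, such that the set {z₁,…,z_k} is closed under inversion, i.e. {z₁,…,z_k} = {z₁^{−1},…,z_k^{−1}}. Let A be the k×n matrix with entries A_{p,j} = (z_p)^{j−1}, and let A′ be the k×n matrix with entries A′_{p,j} = (z₁z₂⋯z_k)·(z_p)^{−j} / ∏_{s≠p}(z_s − z_p). Then the ℂ-linear span of the rows of A′ equals the ℂ-linear span of the rows of A; that is, the Grassmannian twist map fixes V_{{z₁,…,z_k}}. -/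
open scoped BigOperators

/-- if `z₁,…,z_k` are distinct nonzero complex numbers with
`z₁ⁿ = ⋯ = z_kⁿ` and `{z₁,…,z_k}` closed under inversion, then the row span of the
twist matrix `A'` equals the row span of `A = ((z_p)^{j−1})`; that is, the twist map
fixes `V_{{z₁,…,z_k}}`. -/
theorem twist_fixes_VS (k n : ℕ) (hk : 1 ≤ k) (hkn : k ≤ n) (z : Fin k → ℂ)
    (hinj : Function.Injective z) (hz : ∀ r, z r ≠ 0)
    (hpow : ∀ r s, z r ^ n = z s ^ n)
    (hinvcl : Set.range z = (fun w : ℂ => w⁻¹) '' Set.range z)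
    (A A' : Fin k → Fin n → ℂ)
    (hA : A = fun p (j : Fin n) => z p ^ (j : ℕ))
    (hA' : A' = fun p (j : Fin n) =>
      (∏ s : Fin k, z s) * z p ^ (-(((j : ℕ) : ℤ) + 1)) /
        ∏ s ∈ Finset.univ.erase p, (z s - z p)) :
    Submodule.span ℂ (Set.range A') = Submodule.span ℂ (Set.range A) ∧
      Submodule.span ℂ (Set.range A) = VS n (Finset.image z Finset.univ) := by
  subst hA hA'
  have hprod : ∏ s, z s ≠ 0 := Finset.prod_ne_zero_iff.2 fun s _ => hz s
  have hdiff (p : Fin k) : ∏ s ∈ Finset.univ.erase p, (z s - z p) ≠ 0 :=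
    Finset.prod_ne_zero_iff.2 fun s hs =>
      sub_ne_zero.2 fun h => (Finset.mem_erase.1 hs).1 (hinj h)
  have hinv (p : Fin k) : ∃ q, z q = (z p)⁻¹ := by
    rw [← Set.mem_range, hinvcl]
    exact ⟨z p, ⟨p, rfl⟩, rfl⟩
  have hrow (p q : Fin k) (hq : z q = (z p)⁻¹) :
      (fun j : Fin n => (∏ s : Fin k, z s) * z p ^ (-(((j : ℕ) : ℤ) + 1)) /
        ∏ s ∈ Finset.univ.erase p, (z s - z p)) =
      ((∏ s, z s) * z q / ∏ s ∈ Finset.univ.erase p, (z s - z p)) •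
        (fun j : Fin n => z q ^ (j : ℕ)) := by
    funext j
    have hpow_neg : z p ^ (-(((j : ℕ) : ℤ) + 1)) = z q * z q ^ (j : ℕ) := by
      rw [hq, zpow_neg, ← inv_zpow, zpow_add_one₀ (inv_ne_zero (hz p)), zpow_natCast, mul_comm]
    rw [hpow_neg, Pi.smul_apply, smul_eq_mul]
    ring
  refine ⟨le_antisymm ?_ ?_, ?_⟩
  · rw [Submodule.span_le]
    rintro _ ⟨p, rfl⟩
    obtain ⟨q, hq⟩ := hinv p
    dsimp only
    rw [hrow p q hq]
    exact Submodule.smul_mem _ _ (Submodule.subset_span ⟨q, rfl⟩)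
  · rw [Submodule.span_le]
    rintro _ ⟨q, rfl⟩
    obtain ⟨p, hp⟩ := hinv q
    have hq : z q = (z p)⁻¹ := by rw [hp, inv_inv]
    refine (Submodule.smul_mem_iff _
      (div_ne_zero (mul_ne_zero hprod (hz q)) (hdiff p))).1 ?_
    rw [← hrow p q hq]
    exact Submodule.subset_span ⟨p, rfl⟩
  · rw [VS, Finset.coe_image, Finset.coe_univ, Set.image_univ, ← Set.range_comp]
    rfl
end
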